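/- Let C ⊆ H_2^n be a binary equidistant code with even common distance d > 0 that contains the all-zero word. If |C| > (d² + 2d + 8)/4, then the family of supports of the nonzero codewords C \ {0} is a Δ(n, d, d/2)-system. -/

import Mathlib

/-- A `Δ(n,k,l)`-system: a family of `k`-subsets of `[n]` having a common kernel `D` of
size `l` outside of which the members are pairwise disjoint. -/
def IsDeltaSystem (n k l : ℕ) (F : Finset (Finset (Fin n))) : Prop :=
  (∀ A ∈ F, A.card = k) ∧
    ∃ D : Finset (Fin n), D.card = l ∧ (∀ A ∈ F, D ⊆ A) ∧
      ∀ A ∈ F, ∀ B ∈ F, A ≠ B → Disjoint (A \ D) (B \ D)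

section QuasiSymmetric

variable {α : Type*} [DecidableEq α] {F : Finset (Finset α)} {k : ℕ}

theorem sum_card_filter_mem_eq_sum_card_inter (F : Finset (Finset α)) (S : Finset α) :
    ∑ p ∈ S, ((F.filter (p ∈ ·)).card : ℤ) = ∑ B ∈ F, ((B ∩ S).card : ℤ) := by
  simp only [Finset.card_filter, Nat.cast_sum]
  rw [Finset.sum_comm]
  refine Finset.sum_congr rfl fun B _ => ?_
  rw [Finset.inter_comm, ← Finset.filter_mem_eq_inter, Finset.card_filter, Nat.cast_sum]

theorem sum_sq_sum_mem_eq [Fintype α] (c : Finset α → ℤ)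
    (hF : ∀ A ∈ F, ∀ B ∈ F, ((A ∩ B).card : ℤ) = k + if A = B then (k : ℤ) else 0) :
    ∑ x : α, (∑ B ∈ F, if x ∈ B then c B else 0) ^ 2
      = k * ((∑ B ∈ F, c B) ^ 2 + ∑ B ∈ F, c B ^ 2) := by
  have hexp : ∑ x : α, (∑ B ∈ F, if x ∈ B then c B else 0) ^ 2
      = ∑ A ∈ F, ∑ B ∈ F, c A * c B * ((A ∩ B).card : ℤ) := by
    simp only [sq, Finset.sum_mul_sum]
    rw [Finset.sum_comm]
    refine Finset.sum_congr rfl fun A _ => ?_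
    rw [Finset.sum_comm]
    refine Finset.sum_congr rfl fun B _ => ?_
    simp only [ite_mul, mul_ite, zero_mul, mul_zero, ← ite_and, ← Finset.mem_inter]
    simp [Finset.sum_ite, Finset.filter_and, mul_comm, Finset.inter_comm]
  rw [hexp, mul_add, sq, Finset.sum_mul_sum, Finset.mul_sum, Finset.mul_sum,
    ← Finset.sum_add_distrib]
  refine Finset.sum_congr rfl fun A hA => ?_
  rw [Finset.sum_congr rfl fun B hB => by rw [hF A hA B hB, mul_add],
    Finset.sum_add_distrib, Finset.mul_sum]
  congr 1
  · exact Finset.sum_congr rfl fun B _ => by ring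
  · simp [hA]; ring

/-- The number `r` of members of `F` through a point satisfies `r (|F| + 1 - r) ≤ k (|F| + 1)`. -/
theorem card_filter_mem_mul_le [Fintype α]
    (hF : ∀ A ∈ F, ∀ B ∈ F, ((A ∩ B).card : ℤ) = k + if A = B then (k : ℤ) else 0) (p : α) :
    ((F.filter (p ∈ ·)).card : ℤ) * (F.card + 1 - (F.filter (p ∈ ·)).card)
      ≤ k * (F.card + 1) := by
  set r : ℤ := ((F.filter (p ∈ ·)).card : ℤ) with hr
  set N : ℤ := (F.card : ℤ) with hN
  have hrN : r ≤ N := by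
    rw [hr, hN]; exact_mod_cast Finset.card_filter_le _ _
  have hr0 : 0 ≤ r := by positivity
  have hu : ∑ B ∈ F, (if p ∈ B then (1 : ℤ) else 0) = r := by simp [hr]
  set c : Finset α → ℤ := fun B => (N + 1) * (if p ∈ B then 1 else 0) - r with hc
  have hsum : ∑ B ∈ F, c B = r := by
    simp only [hc]
    rw [Finset.sum_sub_distrib, ← Finset.mul_sum, hu, Finset.sum_const, nsmul_eq_mul, ← hN]
    ring
  have hsq : ∑ B ∈ F, c B ^ 2 = ((N + 1) ^ 2 - 2 * (N + 1) * r) * r + N * r ^ 2 := by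
    have : ∀ B ∈ F, c B ^ 2 =
        ((N + 1) ^ 2 - 2 * (N + 1) * r) * (if p ∈ B then 1 else 0) + r ^ 2 := by
      intro B _
      simp only [hc]
      split_ifs <;> ring
    rw [Finset.sum_congr rfl this, Finset.sum_add_distrib, ← Finset.mul_sum, hu,
      Finset.sum_const, nsmul_eq_mul]
  have hp : ∑ B ∈ F, (if p ∈ B then c B else 0) = r * (N + 1 - r) := by
    have : ∀ B ∈ F, (if p ∈ B then c B else 0) = (N + 1 - r) * (if p ∈ B then 1 else 0) := by
      intro B _
      simp only [hc]
      split_ifs <;> ring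
    rw [Finset.sum_congr rfl this, ← Finset.mul_sum, hu]
    ring
  have hle := Finset.single_le_sum
    (f := fun x : α => (∑ B ∈ F, if x ∈ B then c B else 0) ^ 2)
    (fun x _ => sq_nonneg _) (Finset.mem_univ p)
  rw [sum_sq_sum_mem_eq c hF] at hle
  simp only [hp, hsum, hsq] at hle
  rcases hr0.eq_or_lt with h | h
  · rw [← h, zero_mul]; positivity
  · have hpos : 0 < r * (N + 1 - r) := mul_pos h (by linarith)
    refine le_of_mul_le_mul_left ?_ hpos
    linarith

/-- A point of a large family lies on few or on almost all of its members. -/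
theorem card_filter_mem_le_or_ge [Fintype α]
    (hF : ∀ A ∈ F, ∀ B ∈ F, ((A ∩ B).card : ℤ) = k + if A = B then (k : ℤ) else 0)
    (hcard : (k : ℤ) ^ 2 + k + 2 ≤ F.card) (p : α) :
    ((F.filter (p ∈ ·)).card : ℤ) ≤ k + 1 ∨
      (F.card : ℤ) - k ≤ (F.filter (p ∈ ·)).card := by
  have h := card_filter_mem_mul_le hF p
  by_contra! hcon
  obtain ⟨h1, h2⟩ := hcon
  have h1' : (k : ℤ) + 2 ≤ (F.filter (p ∈ ·)).card := by linarith
  have h2' : ((F.filter (p ∈ ·)).card : ℤ) ≤ F.card - k - 1 := by linarith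
  nlinarith [mul_nonneg (sub_nonneg.2 h1') (sub_nonneg.2 h2'), sq_nonneg ((k : ℤ) - 1)]

theorem exists_kernel_of_card_inter_eq [Fintype α]
    (hF : ∀ A ∈ F, ∀ B ∈ F, ((A ∩ B).card : ℤ) = k + if A = B then (k : ℤ) else 0)
    (hcard : (k : ℤ) ^ 2 + k + 2 ≤ F.card) :
    ∃ D : Finset α, D.card = k ∧ ∀ A ∈ F, D ⊆ A := by
  set r : α → ℤ := fun p => ((F.filter (p ∈ ·)).card : ℤ) with hr
  set N : ℤ := (F.card : ℤ) with hN
  set D : Finset α := Finset.univ.filter fun p => (k : ℤ) + 1 < r p with hD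
  have hdich : ∀ p, r p ≤ k + 1 ∨ N - k ≤ r p := card_filter_mem_le_or_ge hF hcard
  have hrN : ∀ p, r p ≤ N := fun p => by
    simp only [hr, hN]; exact_mod_cast Finset.card_filter_le _ _
  have hM : (k : ℤ) ^ 2 < N - k - 1 := by linarith
  have hA2 : ∀ A ∈ F, (A.card : ℤ) = 2 * k := fun A hA => by
    have := hF A hA A hA
    rw [Finset.inter_self, if_pos rfl] at this
    linarith
  have hsumA : ∀ A ∈ F, ∑ p ∈ A, r p = k * N + k := fun A hA => by
    simp only [hr]
    rw [sum_card_filter_mem_eq_sum_card_inter,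
      Finset.sum_congr rfl fun B hB => hF B hB A hA, Finset.sum_add_distrib]
    simp [hA, hN, mul_comm]
  have hind : ∀ A : Finset α,
      ∑ p ∈ A, (if p ∈ D then (1 : ℤ) else 0) = ((A ∩ D).card : ℤ) := fun A => by
    simp
  have hAD : ∀ A ∈ F, ((A ∩ D).card : ℤ) = k := by
    intro A hA
    have hup : ∑ p ∈ A, r p ≤
        ∑ p ∈ A, (((k : ℤ) + 1) + (N - k - 1) * if p ∈ D then 1 else 0) := by
      refine Finset.sum_le_sum fun p _ => ?_
      have := hrN p
      split_ifs with h
      · linarith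
      · simp only [hD, Finset.mem_filter, Finset.mem_univ, true_and, not_lt] at h
        linarith
    have hlow : ∑ p ∈ A, ((1 : ℤ) + (N - k - 1) * if p ∈ D then 1 else 0) ≤ ∑ p ∈ A, r p := by
      refine Finset.sum_le_sum fun p hp => ?_
      split_ifs with h
      · simp only [hD, Finset.mem_filter, Finset.mem_univ, true_and] at h
        rcases hdich p with h' | h' <;> linarith
      · have : 0 < (F.filter (p ∈ ·)).card :=
          Finset.card_pos.2 ⟨A, Finset.mem_filter.2 ⟨hA, hp⟩⟩
        simp only [hr]
        omega
    rw [Finset.sum_add_distrib, ← Finset.mul_sum, hind, Finset.sum_const, nsmul_eq_mul,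
      hA2 A hA, hsumA A hA] at hup hlow
    refine le_antisymm ?_ ?_ <;> by_contra! hlt <;> nlinarith
  have hsumD : ∑ p ∈ D, r p = k * N := by
    simp only [hr]
    rw [sum_card_filter_mem_eq_sum_card_inter, Finset.sum_congr rfl hAD]
    simp [hN, mul_comm]
  have hDlow : (D.card : ℤ) * (N - k) ≤ ∑ p ∈ D, r p := by
    rw [← nsmul_eq_mul]
    refine Finset.card_nsmul_le_sum _ _ _ fun p hp => ?_
    simp only [hD, Finset.mem_filter, Finset.mem_univ, true_and] at hp
    rcases hdich p with h' | h' <;> linarith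
  have hDk : D.card ≤ k := by
    by_contra! hlt
    have : (k : ℤ) + 1 ≤ D.card := by exact_mod_cast hlt
    nlinarith
  have hsub : ∀ A ∈ F, D ⊆ A := fun A hA => by
    have h := hAD A hA
    rw [← Finset.eq_of_subset_of_card_le (Finset.inter_subset_right (s₁ := A) (s₂ := D))
      (by omega)]
    exact Finset.inter_subset_left
  obtain ⟨A, hA⟩ : F.Nonempty := by
    rw [← Finset.card_pos]
    have : (0 : ℤ) < F.card := by nlinarith
    exact_mod_cast this
  refine ⟨D, le_antisymm hDk ?_, hsub⟩
  have h := hAD A hA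
  have := Finset.card_le_card (Finset.inter_subset_right (s₁ := A) (s₂ := D))
  omega

end QuasiSymmetric

theorem hammingDist_add_two_mul_card_inter_support {n : ℕ} (x y : Fin n → Fin 2) :
    hammingDist x y + 2 * ((Finset.univ.filter fun i => x i ≠ 0) ∩
        (Finset.univ.filter fun i => y i ≠ 0)).card
      = hammingDist x 0 + hammingDist y 0 := by
  simp only [hammingDist, ← Finset.filter_and, Finset.card_filter, Finset.mul_sum,
    ← Finset.sum_add_distrib, Pi.zero_apply]
  refine Finset.sum_congr rfl fun i _ => ?_
  generalize x i = a
  generalize y i = b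
  revert a b
  decide

theorem support_injective_binary {n : ℕ} :
    Function.Injective fun x : Fin n → Fin 2 => Finset.univ.filter fun i => x i ≠ 0 := by
  intro x y hxy
  ext i
  have h := Finset.ext_iff.1 hxy i
  simp only [Finset.mem_filter, Finset.mem_univ, true_and] at h
  omega

/-- If a binary equidistant code with even distance `d > 0` contains the all-zero word
and has more than `(d² + 2d + 8)/4` codewords, then the supports of its nonzero
codewords form a `Δ(n, d, d/2)`-system. -/
theorem binary_equidistant_supports_deltaSystem (n d : ℕ) (hd : Even d) (hd0 : 0 < d)
    (C : Finset (Fin n → Fin 2)) (h0 : (0 : Fin n → Fin 2) ∈ C)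
    (hC : ∀ x ∈ C, ∀ y ∈ C, x ≠ y → hammingDist x y = d)
    (hcard : ((d : ℝ) ^ 2 + 2 * d + 8) / 4 < (C.card : ℝ)) :
    IsDeltaSystem n d (d / 2)
      ((C.erase 0).image fun x => Finset.univ.filter fun i => x i ≠ 0) := by
  obtain ⟨k, rfl⟩ := hd
  have hhalf : (k + k) / 2 = k := by omega
  rw [hhalf]
  set F := (C.erase 0).image fun x => Finset.univ.filter fun i => x i ≠ 0 with hFdef
  have hF : ∀ A ∈ F, ∀ B ∈ F, ((A ∩ B).card : ℤ) = k + if A = B then (k : ℤ) else 0 := by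
    intro A hA B hB
    obtain ⟨x, hx, rfl⟩ := Finset.mem_image.1 hA
    obtain ⟨y, hy, rfl⟩ := Finset.mem_image.1 hB
    rw [Finset.mem_erase] at hx hy
    have h := hammingDist_add_two_mul_card_inter_support x y
    rw [hC x hx.2 0 h0 hx.1, hC y hy.2 0 h0 hy.1] at h
    by_cases hxy : x = y
    · subst hxy
      rw [hammingDist_self] at h
      rw [if_pos rfl]
      omega
    · rw [hC x hx.2 y hy.2 hxy] at h
      rw [if_neg (support_injective_binary.ne hxy)]
      omega
  have hFcard : (k : ℤ) ^ 2 + k + 2 ≤ F.card := by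
    rw [hFdef, Finset.card_image_of_injective _ support_injective_binary,
      Finset.card_erase_of_mem h0]
    have h : (k : ℝ) ^ 2 + k + 2 < (C.card : ℝ) := by
      push_cast at hcard
      linarith
    have h' : k ^ 2 + k + 2 < C.card := by exact_mod_cast h
    have h'' : k ^ 2 + k + 2 ≤ C.card - 1 := by omega
    exact_mod_cast h''
  obtain ⟨D, hDk, hDsub⟩ := exists_kernel_of_card_inter_eq hF hFcard
  refine ⟨fun A hA => ?_, D, hDk, hDsub, fun A hA B hB hAB => ?_⟩
  · have h := hF A hA A hA
    rw [Finset.inter_self, if_pos rfl] at h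
    exact_mod_cast h
  · have h := hF A hA B hB
    rw [if_neg hAB, add_zero] at h
    have hD : D = A ∩ B := Finset.eq_of_subset_of_card_le
      (Finset.subset_inter (hDsub A hA) (hDsub B hB)) (by omega)
    rw [Finset.disjoint_left]
    intro i hiA hiB
    rw [Finset.mem_sdiff] at hiA hiB
    exact hiA.2 (hD ▸ Finset.mem_inter.2 ⟨hiA.1, hiB.1⟩)
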